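/- Let P = {x ∈ [0,2]² : x₁ + 10x₂ ≤ 20, 10x₁ + x₂ ≤ 20}, let P_L = {(x,z) ∈ ℝ² × [0,1]⁴ : x ∈ P, x_i = z_{i1} + 2z_{i2} for i = 1,2} be its logarithmic binary extended formulation, and let P_{L+} = {(x,z) ∈ P_L : z_{i1} + z_{i2} ≤ 1 for i = 1,2} be its perfect logarithmic binary extended formulation. Then proj_x(SC(P_{L+})) ⊊ proj_x(SC(P_L)), where both split closures are taken with respect to all six variables. In particular, the point (6/5, 6/5) belongs to proj_x(SC(P_L)) but not to proj_x(SC(P_{L+})), since x₁ + x₂ ≤ 2 is valid for SC(P_{L+}). -/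

import Mathlib

open Set

/-- The split closure of `P` with respect to a family `Λ` of (integral) linear
functionals. -/
noncomputable def splitClosure {E : Type*} [AddCommGroup E] [Module ℝ E]
    (Λ : Set (E → ℝ)) (P : Set E) : Set E :=
  ⋂ f ∈ Λ, ⋂ c : ℤ, convexHull ℝ (P \ {x | (c : ℝ) < f x ∧ f x < c + 1})

/-- Split functionals on the extended space `ℝ² × (ℝ² × ℝ²)` with integer coefficients
on all six variables. -/
def splitsAll : Set (((ℝ × ℝ) × ((ℝ × ℝ) × (ℝ × ℝ))) → ℝ) :=
  {f | ∃ a₁ a₂ c₁₁ c₁₂ c₂₁ c₂₂ : ℤ, f = fun p =>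
    (a₁ : ℝ) * p.1.1 + (a₂ : ℝ) * p.1.2 +
    (c₁₁ : ℝ) * p.2.1.1 + (c₁₂ : ℝ) * p.2.1.2 + (c₂₁ : ℝ) * p.2.2.1 + (c₂₂ : ℝ) * p.2.2.2}

/-- A point on a segment whose endpoints lie in `K` and outside the open strip
`c < f < c + 1` lies in the convex hull of `K` minus the strip. The values of `f` at the
endpoints are the fractions `x / m` and `y / n`, so that the strip conditions are stated
over `ℤ`. -/
lemma mem_convexHull_diff_strip {E : Type*} [AddCommGroup E] [Module ℝ E] {K : Set E}
    {f : E → ℝ} {c m n x y : ℤ} (hm : 0 < m) (hn : 0 < n) {p q q' : E} {α β : ℝ}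
    (hα : 0 ≤ α) (hβ : 0 ≤ β) (hαβ : α + β = 1) (hp : α • q + β • q' = p)
    (hq : q ∈ K) (hq' : q' ∈ K) (hfq : m * f q = x) (hfq' : n * f q' = y)
    (hx : x ≤ m * c ∨ m * (c + 1) ≤ x) (hy : y ≤ n * c ∨ n * (c + 1) ≤ y) :
    p ∈ convexHull ℝ (K \ {z | (c : ℝ) < f z ∧ f z < c + 1}) := by
  have outside : ∀ {m x : ℤ} {z : E}, 0 < m → m * f z = x →
      (x ≤ m * c ∨ m * (c + 1) ≤ x) → ¬ ((c : ℝ) < f z ∧ f z < c + 1) := by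
    rintro m x z hm hf (h | h) ⟨h₁, h₂⟩
    all_goals
      have hm' : (0 : ℝ) < m := by exact_mod_cast hm
    · have h' : (x : ℝ) ≤ m * c := by exact_mod_cast h
      nlinarith
    · have h' : (m : ℝ) * (c + 1) ≤ x := by exact_mod_cast h
      nlinarith
  rw [← hp]
  refine convex_convexHull ℝ _ ?_ ?_ hα hβ hαβ
  · exact subset_convexHull ℝ _ ⟨hq, outside hm hfq hx⟩
  · exact subset_convexHull ℝ _ ⟨hq', outside hn hfq' hy⟩

lemma splitClosure_mono {E : Type*} [AddCommGroup E] [Module ℝ E] (Λ : Set (E → ℝ))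
    {K L : Set E} (h : K ⊆ L) : splitClosure Λ K ⊆ splitClosure Λ L :=
  iInter₂_mono fun _ _ => iInter_mono fun _ => convexHull_mono (sdiff_subset_sdiff_left h)

/-- If the side `f ≥ c + 1` of a split misses `K`, then the Chvátal inequality `f ≤ c` is
valid for the split closure. -/
lemma le_of_mem_splitClosure {E : Type*} [AddCommGroup E] [Module ℝ E] {Λ : Set (E → ℝ)}
    {K : Set E} (f : E → ℝ) (hf : f ∈ Λ) (hlin : IsLinearMap ℝ f) (c : ℤ)
    (hK : ∀ p ∈ K, f p < c + 1) {p : E} (hp : p ∈ splitClosure Λ K) : f p ≤ c := by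
  have hp' := mem_iInter.1 (mem_iInter₂.1 hp f hf) c
  refine convexHull_min (t := {x | f x ≤ c}) ?_ (convex_halfSpace_le hlin _) hp'
  rintro x ⟨hx, hxs⟩
  by_contra h
  exact hxs ⟨not_le.1 h, hK x hx⟩

/-- The functional `(u, v, s, t)` takes the value `(10u + 7v + 10s + 7t) / 20` at the point
`z = (1/2, 7/20, 1/2, 7/20)`. If this lies strictly between `c` and `c + 1`, then one of nine
fixed segments through `z` has both endpoints outside the strip; the last four segments are
parallel to the axes and handle the functionals with a large coefficient. -/
lemma exists_segment_outside_strip (u v s t c : ℤ) (h₁ : 20 * c < 10 * u + 7 * v + 10 * s + 7 * t)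
    (h₂ : 10 * u + 7 * v + 10 * s + 7 * t < 20 * (c + 1)) :
    ((u + s ≤ 1 * c ∨ 1 * (c + 1) ≤ u + s) ∧
      (7 * v + 7 * t ≤ 10 * c ∨ 10 * (c + 1) ≤ 7 * v + 7 * t)) ∨
    ((t ≤ 1 * c ∨ 1 * (c + 1) ≤ t) ∧
      (10 * u + 7 * v + 10 * s ≤ 13 * c ∨ 13 * (c + 1) ≤ 10 * u + 7 * v + 10 * s)) ∨
    ((v ≤ 1 * c ∨ 1 * (c + 1) ≤ v) ∧
      (10 * u + 10 * s + 7 * t ≤ 13 * c ∨ 13 * (c + 1) ≤ 10 * u + 10 * s + 7 * t)) ∨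
    ((3 * u + 3 * v + 5 * s + 2 * t ≤ 5 * c ∨ 5 * (c + 1) ≤ 3 * u + 3 * v + 5 * s + 2 * t) ∧
      (4 * u + v + 3 * t ≤ 10 * c ∨ 10 * (c + 1) ≤ 4 * u + v + 3 * t)) ∨
    ((20 * u + 7 * v + 14 * t ≤ 20 * c ∨ 20 * (c + 1) ≤ 20 * u + 7 * v + 14 * t) ∧
      (7 * v + 20 * s ≤ 20 * c ∨ 20 * (c + 1) ≤ 7 * v + 20 * s)) ∨
    ((7 * v + 10 * s + 7 * t ≤ 20 * c ∨ 20 * (c + 1) ≤ 7 * v + 10 * s + 7 * t) ∧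
      (20 * u + 7 * v + 10 * s + 7 * t ≤ 20 * c ∨
        20 * (c + 1) ≤ 20 * u + 7 * v + 10 * s + 7 * t)) ∨
    ((10 * u + 7 * v + 7 * t ≤ 20 * c ∨ 20 * (c + 1) ≤ 10 * u + 7 * v + 7 * t) ∧
      (10 * u + 7 * v + 20 * s + 7 * t ≤ 20 * c ∨
        20 * (c + 1) ≤ 10 * u + 7 * v + 20 * s + 7 * t)) ∨
    ((30 * u + v + 30 * s + 21 * t ≤ 60 * c ∨
        60 * (c + 1) ≤ 30 * u + v + 30 * s + 21 * t) ∧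
      (30 * u + 41 * v + 30 * s + 21 * t ≤ 60 * c ∨
        60 * (c + 1) ≤ 30 * u + 41 * v + 30 * s + 21 * t)) ∨
    ((30 * u + 21 * v + 30 * s + t ≤ 60 * c ∨
        60 * (c + 1) ≤ 30 * u + 21 * v + 30 * s + t) ∧
      (30 * u + 21 * v + 30 * s + 41 * t ≤ 60 * c ∨
        60 * (c + 1) ≤ 30 * u + 21 * v + 30 * s + 41 * t)) := by
  by_cases hu : 2 ≤ u ∨ u ≤ -2
  · iterate 5 right
    left
    omega
  by_cases hs : 2 ≤ s ∨ s ≤ -2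
  · iterate 6 right
    left
    omega
  by_cases hv : 3 ≤ v ∨ v ≤ -3
  · iterate 7 right
    left
    omega
  by_cases ht : 3 ≤ t ∨ t ≤ -3
  · iterate 8 right
    omega
  have hu' : -1 ≤ u ∧ u ≤ 1 := by omega
  have hs' : -1 ≤ s ∧ s ≤ 1 := by omega
  have hv' : -2 ≤ v ∧ v ≤ 2 := by omega
  have ht' : -2 ≤ t ∧ t ≤ 2 := by omega
  clear hu hs hv ht
  obtain ⟨hu₁, hu₂⟩ := hu'
  obtain ⟨hs₁, hs₂⟩ := hs'
  obtain ⟨hv₁, hv₂⟩ := hv'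
  obtain ⟨ht₁, ht₂⟩ := ht'
  interval_cases u <;> interval_cases s <;> interval_cases v <;> interval_cases t <;> omega

/-- Let `P = {x ∈ [0,2]² : x₁ + 10x₂ ≤ 20, 10x₁ + x₂ ≤ 20}`, let
`P_L` be its logarithmic binary extended formulation and `P_{L+}` its perfect version
(adding `z_{i1} + z_{i2} ≤ 1`).  Then `proj_x(SC(P_{L+})) ⊊ proj_x(SC(P_L))`; in
particular `(6/5, 6/5) ∈ proj_x(SC(P_L))` but `(6/5, 6/5) ∉ proj_x(SC(P_{L+}))`,
since `x₁ + x₂ ≤ 2` is valid for `SC(P_{L+})`. -/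
theorem stmt11 (P : Set (ℝ × ℝ))
    (hP : P = {x | 0 ≤ x.1 ∧ x.1 ≤ 2 ∧ 0 ≤ x.2 ∧ x.2 ≤ 2 ∧
      x.1 + 10 * x.2 ≤ 20 ∧ 10 * x.1 + x.2 ≤ 20})
    (PL PLplus : Set ((ℝ × ℝ) × ((ℝ × ℝ) × (ℝ × ℝ))))
    (hPL : PL = {p | p.1 ∈ P ∧
      (0 ≤ p.2.1.1 ∧ p.2.1.1 ≤ 1) ∧ (0 ≤ p.2.1.2 ∧ p.2.1.2 ≤ 1) ∧
      (0 ≤ p.2.2.1 ∧ p.2.2.1 ≤ 1) ∧ (0 ≤ p.2.2.2 ∧ p.2.2.2 ≤ 1) ∧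
      p.1.1 = p.2.1.1 + 2 * p.2.1.2 ∧ p.1.2 = p.2.2.1 + 2 * p.2.2.2})
    (hPLplus : PLplus = {p ∈ PL | p.2.1.1 + p.2.1.2 ≤ 1 ∧ p.2.2.1 + p.2.2.2 ≤ 1}) :
    Prod.fst '' splitClosure splitsAll PLplus ⊂ Prod.fst '' splitClosure splitsAll PL ∧
    ((6 / 5 : ℝ), (6 / 5 : ℝ)) ∈ Prod.fst '' splitClosure splitsAll PL ∧
    ((6 / 5 : ℝ), (6 / 5 : ℝ)) ∉ Prod.fst '' splitClosure splitsAll PLplus ∧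
    (∀ p ∈ splitClosure splitsAll PLplus, p.1.1 + p.1.2 ≤ 2) := by
  have hvalid : ∀ p ∈ splitClosure splitsAll PLplus, p.1.1 + p.1.2 ≤ 2 := by
    intro p hp
    have hcut : ∀ a₁ a₂ c₁₂ c₂₂ : ℤ,
        (∀ q ∈ PLplus, a₁ * q.1.1 + a₂ * q.1.2 + c₁₂ * q.2.1.2 + c₂₂ * q.2.2.2 < (2 : ℝ)) →
        a₁ * p.1.1 + a₂ * p.1.2 + c₁₂ * p.2.1.2 + c₂₂ * p.2.2.2 ≤ (1 : ℝ) := by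
      intro a₁ a₂ c₁₂ c₂₂ h
      have := le_of_mem_splitClosure (Λ := splitsAll) (K := PLplus) (p := p)
        (fun p => a₁ * p.1.1 + a₂ * p.1.2 + (0 : ℤ) * p.2.1.1 + c₁₂ * p.2.1.2 +
          (0 : ℤ) * p.2.2.1 + c₂₂ * p.2.2.2) ⟨a₁, a₂, 0, c₁₂, 0, c₂₂, rfl⟩
        ⟨fun x y => by simp only [Prod.fst_add, Prod.snd_add]; ring,
          fun r x => by simp only [Prod.smul_fst, Prod.smul_snd, smul_eq_mul]; ring⟩ 1
        (fun q hq => by have := h q hq; push_cast; linarith) hp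
      push_cast at this
      linarith
    have h₁ := hcut 1 0 (-1) 1 (by
      subst hPLplus hPL hP
      rintro ⟨⟨x₁, x₂⟩, ⟨⟨a, b⟩, ⟨c, d⟩⟩⟩ hq
      simp only [mem_ofPred_eq] at hq
      push_cast
      linarith)
    have h₂ := hcut 0 1 1 (-1) (by
      subst hPLplus hPL hP
      rintro ⟨⟨x₁, x₂⟩, ⟨⟨a, b⟩, ⟨c, d⟩⟩⟩ hq
      simp only [mem_ofPred_eq] at hq
      push_cast
      linarith)
    push_cast at h₁ h₂
    linarith
  have hmem : ((6 / 5 : ℝ), (6 / 5 : ℝ)) ∈ Prod.fst '' splitClosure splitsAll PL := by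
    refine ⟨((6 / 5, 6 / 5), ((1 / 2, 7 / 20), (1 / 2, 7 / 20))), ?_, rfl⟩
    refine mem_iInter₂.2 fun f hf => mem_iInter.2 fun c => ?_
    obtain ⟨a₁, a₂, c₁₁, c₁₂, c₂₁, c₂₂, rfl⟩ := hf
    have hlift : ∀ a b c d : ℝ, ((0 ≤ a ∧ a ≤ 1) ∧ (0 ≤ b ∧ b ≤ 1) ∧ (0 ≤ c ∧ c ≤ 1) ∧
        (0 ≤ d ∧ d ≤ 1) ∧ a + 2 * b + 10 * (c + 2 * d) ≤ 20 ∧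
        10 * (a + 2 * b) + (c + 2 * d) ≤ 20) →
        ((a + 2 * b, c + 2 * d), ((a, b), (c, d))) ∈ PL := by
      rintro a b c d ⟨⟨_, _⟩, ⟨_, _⟩, ⟨_, _⟩, ⟨_, _⟩, _, _⟩
      subst hPL hP
      refine ⟨⟨?_, ?_, ?_, ?_, ?_, ?_⟩, ⟨?_, ?_⟩, ⟨?_, ?_⟩, ⟨?_, ?_⟩, ⟨?_, ?_⟩, rfl, rfl⟩ <;>
        linarith
    by_cases hc : 20 * c < 10 * (c₁₁ + a₁) + 7 * (c₁₂ + 2 * a₁) + 10 * (c₂₁ + a₂) +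
        7 * (c₂₂ + 2 * a₂) ∧ 10 * (c₁₁ + a₁) + 7 * (c₁₂ + 2 * a₁) + 10 * (c₂₁ + a₂) +
        7 * (c₂₂ + 2 * a₂) < 20 * (c + 1)
    · obtain ⟨hx, hy⟩ | ⟨hx, hy⟩ | ⟨hx, hy⟩ | ⟨hx, hy⟩ | ⟨hx, hy⟩ | ⟨hx, hy⟩ | ⟨hx, hy⟩ |
        ⟨hx, hy⟩ | ⟨hx, hy⟩ := exists_segment_outside_strip _ _ _ _ c hc.1 hc.2
      · exact mem_convexHull_diff_strip (α := 1 / 2) (β := 1 / 2) (by norm_num) (by norm_num)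
          (by norm_num) (by norm_num) (by norm_num) (by ext <;> norm_num)
          (hlift 1 0 1 0 (by norm_num))
          (hlift 0 (7 / 10) 0 (7 / 10) (by norm_num))
          (by push_cast; ring) (by push_cast; ring) hx hy
      · exact mem_convexHull_diff_strip (α := 7 / 20) (β := 13 / 20) (by norm_num) (by norm_num)
          (by norm_num) (by norm_num) (by norm_num) (by ext <;> norm_num)
          (hlift 0 0 0 1 (by norm_num))
          (hlift (10 / 13) (7 / 13) (10 / 13) 0 (by norm_num))
          (by push_cast; ring) (by push_cast; ring) hx hy
      · exact mem_convexHull_diff_strip (α := 7 / 20) (β := 13 / 20) (by norm_num) (by norm_num)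
          (by norm_num) (by norm_num) (by norm_num) (by ext <;> norm_num)
          (hlift 0 1 0 0 (by norm_num))
          (hlift (10 / 13) 0 (10 / 13) (7 / 13) (by norm_num))
          (by push_cast; ring) (by push_cast; ring) hx hy
      · exact mem_convexHull_diff_strip (α := 1 / 2) (β := 1 / 2) (by norm_num) (by norm_num)
          (by norm_num) (by norm_num) (by norm_num) (by ext <;> norm_num)
          (hlift (3 / 5) (3 / 5) 1 (2 / 5) (by norm_num))
          (hlift (2 / 5) (1 / 10) 0 (3 / 10) (by norm_num))
          (by push_cast; ring) (by push_cast; ring) hx hy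
      · exact mem_convexHull_diff_strip (α := 1 / 2) (β := 1 / 2) (by norm_num) (by norm_num)
          (by norm_num) (by norm_num) (by norm_num) (by ext <;> norm_num)
          (hlift 1 (7 / 20) 0 (7 / 10) (by norm_num))
          (hlift 0 (7 / 20) 1 0 (by norm_num))
          (by push_cast; ring) (by push_cast; ring) hx hy
      · exact mem_convexHull_diff_strip (α := 1 / 2) (β := 1 / 2) (by norm_num) (by norm_num)
          (by norm_num) (by norm_num) (by norm_num) (by ext <;> norm_num)
          (hlift 0 (7 / 20) (1 / 2) (7 / 20) (by norm_num))
          (hlift 1 (7 / 20) (1 / 2) (7 / 20) (by norm_num))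
          (by push_cast; ring) (by push_cast; ring) hx hy
      · exact mem_convexHull_diff_strip (α := 1 / 2) (β := 1 / 2) (by norm_num) (by norm_num)
          (by norm_num) (by norm_num) (by norm_num) (by ext <;> norm_num)
          (hlift (1 / 2) (7 / 20) 0 (7 / 20) (by norm_num))
          (hlift (1 / 2) (7 / 20) 1 (7 / 20) (by norm_num))
          (by push_cast; ring) (by push_cast; ring) hx hy
      · exact mem_convexHull_diff_strip (α := 1 / 2) (β := 1 / 2) (by norm_num) (by norm_num)
          (by norm_num) (by norm_num) (by norm_num) (by ext <;> norm_num)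
          (hlift (1 / 2) (1 / 60) (1 / 2) (7 / 20) (by norm_num))
          (hlift (1 / 2) (41 / 60) (1 / 2) (7 / 20) (by norm_num))
          (by push_cast; ring) (by push_cast; ring) hx hy
      · exact mem_convexHull_diff_strip (α := 1 / 2) (β := 1 / 2) (by norm_num) (by norm_num)
          (by norm_num) (by norm_num) (by norm_num) (by ext <;> norm_num)
          (hlift (1 / 2) (7 / 20) (1 / 2) (1 / 60) (by norm_num))
          (hlift (1 / 2) (7 / 20) (1 / 2) (41 / 60) (by norm_num))
          (by push_cast; ring) (by push_cast; ring) hx hy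
    · have hx : 10 * (c₁₁ + a₁) + 7 * (c₁₂ + 2 * a₁) + 10 * (c₂₁ + a₂) + 7 * (c₂₂ + 2 * a₂) ≤
          20 * c ∨ 20 * (c + 1) ≤
          10 * (c₁₁ + a₁) + 7 * (c₁₂ + 2 * a₁) + 10 * (c₂₁ + a₂) + 7 * (c₂₂ + 2 * a₂) := by
        omega
      exact mem_convexHull_diff_strip (α := 1) (β := 0) (by norm_num) (by norm_num)
        (by norm_num) (by norm_num) (by norm_num) (by ext <;> norm_num)
        (hlift (1 / 2) (7 / 20) (1 / 2) (7 / 20) (by norm_num))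
        (hlift (1 / 2) (7 / 20) (1 / 2) (7 / 20) (by norm_num))
        (by push_cast; ring) (by push_cast; ring) hx hx
  have hnot : ((6 / 5 : ℝ), (6 / 5 : ℝ)) ∉ Prod.fst '' splitClosure splitsAll PLplus := by
    rintro ⟨p, hp, h⟩
    have := hvalid p hp
    rw [h] at this
    norm_num at this
  refine ⟨?_, hmem, hnot, hvalid⟩
  refine (ssubset_iff_of_subset (image_mono (splitClosure_mono _ ?_))).2 ⟨_, hmem, hnot⟩
  rw [hPLplus]
  exact sep_subset _ _
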